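/- Let α' be a suffix of α with |α'| > |α^a|. Then α' occurs at least twice in A or occurs at least twice in B if and only if N(α') ≥ 2, where N(α') is the number of suffixes of A having α' as a prefix plus the number of suffixes of α^aδγ of length greater than |γ| having α' as a prefix. (This is Corollary 1.) -/

import Mathlib

/-- A string `χ` occurs in `S` at position `p` if `S = u ++ χ ++ v` with `|u| = p`. -/
def OccursAt {σ : Type*} (χ S : List σ) (p : ℕ) : Prop :=
  ∃ u v : List σ, S = u ++ χ ++ v ∧ u.length = p

/-- A string `χ` occurs at least twice in `S` if it occurs at two distinct positions. -/
def OccursTwice {σ : Type*} (χ S : List σ) : Prop :=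
  ∃ p q : ℕ, p ≠ q ∧ OccursAt χ S p ∧ OccursAt χ S q

/-- The number of suffixes of `S` having `χ` as a prefix. -/
def countSuffixesWithPrefix {σ : Type*} [DecidableEq σ] (χ S : List σ) : ℕ :=
  ((Finset.range (S.length + 1)).filter (fun j => χ <+: S.drop j)).card

/-- The number of suffixes of `S` of length greater than `ℓ` having `χ` as a prefix. -/
def countLongSuffixesWithPrefix {σ : Type*} [DecidableEq σ] (χ S : List σ) (ℓ : ℕ) : ℕ :=
  ((Finset.range (S.length + 1)).filter
    (fun j => ℓ < (S.drop j).length ∧ χ <+: S.drop j)).card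

theorem occursAt_iff_prefix_drop {σ : Type*} {χ S : List σ} {p : ℕ} :
    OccursAt χ S p ↔ p ≤ S.length ∧ χ <+: S.drop p := by
  constructor
  · rintro ⟨u, v, rfl, rfl⟩
    exact ⟨by simp, by simp⟩
  · rintro ⟨hp, v, hv⟩
    exact ⟨S.take p, v, by rw [List.append_assoc, hv, List.take_append_drop], by simpa using hp⟩

theorem occursAt_iff_getElem? {σ : Type*} {χ S : List σ} {p : ℕ} :
    OccursAt χ S p ↔
      p + χ.length ≤ S.length ∧ ∀ i < χ.length, S[p + i]? = χ[i]? := by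
  rw [occursAt_iff_prefix_drop]
  constructor
  · rintro ⟨hp, h⟩
    have hle := h.length_le
    rw [List.length_drop] at hle
    refine ⟨by omega, fun i hi => ?_⟩
    rw [← List.getElem?_drop]
    rw [List.prefix_iff_getElem?.1 h i hi, List.getElem?_eq_getElem hi]
  · rintro ⟨hp, h⟩
    refine ⟨by omega, ?_⟩
    rw [List.prefix_iff_getElem?]
    intro i hi
    rw [List.getElem?_drop, h i hi, List.getElem?_eq_getElem hi]

theorem OccursAt.append_left {σ : Type*} {χ S : List σ} {p : ℕ} (h : OccursAt χ S p)
    (T : List σ) : OccursAt χ (T ++ S) (T.length + p) := by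
  obtain ⟨u, v, rfl, rfl⟩ := h
  exact ⟨T ++ u, v, by simp, by simp⟩

theorem OccursAt.append_right {σ : Type*} {χ S : List σ} {p : ℕ} (h : OccursAt χ S p)
    (T : List σ) : OccursAt χ (S ++ T) p := by
  obtain ⟨u, v, rfl, rfl⟩ := h
  exact ⟨u, v ++ T, by simp, rfl⟩

theorem OccursAt.of_append_left {σ : Type*} {χ S T : List σ} {p : ℕ}
    (h : OccursAt χ (T ++ S) (T.length + p)) : OccursAt χ S p := by
  rw [occursAt_iff_prefix_drop] at h ⊢
  simpa using h

theorem OccursAt.of_append_right {σ : Type*} {χ S T : List σ} {p : ℕ}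
    (h : OccursAt χ (S ++ T) p) (hp : p + χ.length ≤ S.length) : OccursAt χ S p := by
  rw [occursAt_iff_getElem?] at h ⊢
  refine ⟨hp, fun i hi => ?_⟩
  rw [← h.2 i hi, List.getElem?_append_left (by omega)]

theorem List.IsSuffix.occursAt {σ : Type*} {χ S : List σ} (h : χ <:+ S) :
    OccursAt χ S (S.length - χ.length) := by
  obtain ⟨u, rfl⟩ := h
  exact ⟨u, [], by simp, by simp⟩

/-- An occurrence of a suffix `χ` of `S` that starts inside `S` and runs over its end makes the
overlap, a shorter suffix of `S`, a prefix of `χ`. -/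
theorem OccursAt.occursAt_overlap {σ : Type*} {χ S T : List σ} {p : ℕ}
    (h : OccursAt χ (S ++ T) p) (hsuf : χ <:+ S) (hp : p ≤ S.length)
    (hlt : S.length - χ.length < p) :
    OccursAt (S.drop p) S (S.length - χ.length) := by
  have hχ := hsuf.occursAt
  rw [occursAt_iff_getElem?] at h hχ ⊢
  have hle := hsuf.length_le
  rw [List.length_drop]
  refine ⟨by omega, fun i hi => ?_⟩
  rw [hχ.2 i (by omega), ← h.2 i (by omega), List.getElem?_drop,
    List.getElem?_append_left (by omega)]

theorem countSuffixesWithPrefix_eq_one {σ : Type*} [DecidableEq σ] {χ S : List σ} {p : ℕ}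
    (h : OccursAt χ S p) (hnot : ¬ OccursTwice χ S) : countSuffixesWithPrefix χ S = 1 := by
  rw [countSuffixesWithPrefix, Finset.card_eq_one]
  refine ⟨p, Finset.eq_singleton_iff_unique_mem.2 ⟨?_, fun q hq => ?_⟩⟩
  · rw [Finset.mem_filter, Finset.mem_range, Nat.lt_succ_iff]
    exact occursAt_iff_prefix_drop.1 h
  · rw [Finset.mem_filter, Finset.mem_range, Nat.lt_succ_iff] at hq
    by_contra hne
    exact hnot ⟨q, p, hne, occursAt_iff_prefix_drop.2 hq, h⟩

theorem countLongSuffixesWithPrefix_pos_iff {σ : Type*} [DecidableEq σ] {χ S : List σ} {l : ℕ} :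
    0 < countLongSuffixesWithPrefix χ S l ↔ ∃ p, p + l < S.length ∧ OccursAt χ S p := by
  rw [countLongSuffixesWithPrefix, Finset.card_pos]
  refine exists_congr fun p => ?_
  rw [Finset.mem_filter, Finset.mem_range, occursAt_iff_prefix_drop, List.length_drop]
  refine ⟨fun ⟨_, _, h⟩ => ⟨by omega, by omega, h⟩, fun ⟨_, _, h⟩ => ⟨by omega, by omega, h⟩⟩

/-- **Corollary 1.** Let `A = αβγ`, `B = αδγ`, and let `αa` be the longest suffix of `α`
occurring at least twice in `A`.  Assume `γ` is nonempty and its last symbol occurs in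
`A` and in `B` only at the last position.  For any suffix `α'` of `α` longer than `αa`,
`α'` occurs at least twice in `A` or in `B` iff `N(α') ≥ 2`. -/
theorem corollary_one {σ : Type*} [DecidableEq σ] (α β γ δ αa : List σ)
    (hαa_suf : αa <:+ α)
    (hαa_twice : OccursTwice αa (α ++ β ++ γ))
    (hαa_max : ∀ χ : List σ, χ <:+ α → αa.length < χ.length →
      ¬ OccursTwice χ (α ++ β ++ γ))
    (hγ : γ ≠ [])
    (hlastA : ∀ p : ℕ, OccursAt [γ.getLast hγ] (α ++ β ++ γ) p →
      p = (α ++ β ++ γ).length - 1)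
    (hlastB : ∀ p : ℕ, OccursAt [γ.getLast hγ] (α ++ δ ++ γ) p →
      p = (α ++ δ ++ γ).length - 1)
    (α' : List σ) (hsuf : α' <:+ α) (hlen : αa.length < α'.length) :
    (OccursTwice α' (α ++ β ++ γ) ∨ OccursTwice α' (α ++ δ ++ γ)) ↔
      2 ≤ countSuffixesWithPrefix α' (α ++ β ++ γ) +
          countLongSuffixesWithPrefix α' (αa ++ δ ++ γ) γ.length := by
  have hnotA := hαa_max α' hsuf hlen
  have hle := hsuf.length_le
  have hocc := hsuf.occursAt
  have hoccA : OccursAt α' (α ++ β ++ γ) (α.length - α'.length) :=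
    (hocc.append_right β).append_right γ
  have hoccB : OccursAt α' (α ++ δ ++ γ) (α.length - α'.length) :=
    (hocc.append_right δ).append_right γ
  rw [countSuffixesWithPrefix_eq_one hoccA hnotA, or_iff_right hnotA,
    show ∀ n, 2 ≤ 1 + n ↔ 0 < n by omega, countLongSuffixesWithPrefix_pos_iff]
  constructor
  · intro htwice
    obtain ⟨p, hne, hp⟩ :
        ∃ p, p ≠ α.length - α'.length ∧ OccursAt α' (α ++ δ ++ γ) p := by
      obtain ⟨p, q, hpq, hp, hq⟩ := htwice
      by_cases h : p = α.length - α'.length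
      · exact ⟨q, fun hq' => hpq (h.trans hq'.symm), hq⟩
      · exact ⟨p, h, hp⟩
    have hp_lt : p < α.length + δ.length := by
      by_contra! hge
      obtain ⟨k, rfl⟩ := Nat.exists_eq_add_of_le hge
      rw [← List.length_append] at hp
      have hA := hp.of_append_left.append_left (α ++ β)
      refine hnotA ⟨_, _, ?_, hA, hoccA⟩
      rw [List.length_append]
      omega
    have hp_ge : α.length - αa.length ≤ p := by
      by_contra! hlt
      rw [List.append_assoc] at hp
      rcases lt_or_gt_of_ne hne with hbefore | hafter
      · have hA := ((hp.of_append_right (by omega)).append_right β).append_right γ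
        exact hnotA ⟨_, _, hne, hA, hoccA⟩
      · have hdrop : α.drop p <:+ α := List.drop_suffix p α
        refine hαa_max _ hdrop (by rw [List.length_drop]; omega) ⟨_, _, ?_,
          ((hp.occursAt_overlap hsuf (by omega) hafter).append_right β).append_right γ,
          (hdrop.occursAt.append_right β).append_right γ⟩
        rw [List.length_drop]
        omega
    obtain ⟨ρ, rfl⟩ := hαa_suf
    rw [List.length_append] at hp_ge hp_lt
    obtain ⟨k, rfl⟩ : ∃ k, p = ρ.length + k := ⟨p - ρ.length, by omega⟩
    refine ⟨k, by simp only [List.length_append]; omega, ?_⟩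
    rw [List.append_assoc, List.append_assoc] at hp
    rw [List.append_assoc]
    exact hp.of_append_left
  · rintro ⟨p, -, hp⟩
    obtain ⟨ρ, rfl⟩ := hαa_suf
    have hB := hp.append_left ρ
    rw [← List.append_assoc, ← List.append_assoc] at hB
    refine ⟨_, _, ?_, hB, hoccB⟩
    rw [List.length_append] at hle ⊢
    omega
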